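/- Let V ⊆ ℂ be a nonempty simply connected domain (connected open set) and let ρ be a holomorphic function on V. Then there exist holomorphic functions w₁, w₂ on V satisfying Hill's equation wᵢ'' + (ρ/4) wᵢ = 0 on V whose Wronskian satisfies w₁ w₂' − w₂ w₁' = 1/2 identically on V. -/

import Mathlib

open Filter Topology Set Metric

/-- On a simply connected, locally path connected space, local functions `F i` with locally constant
differences glue, up to locally constant corrections, to a global function. -/
theorem exists_sub_eventually_const_of_simplyConnected {B ι G : Type*} [TopologicalSpace B]
    [SimplyConnectedSpace B] [LocallyPathConnectedSpace B] [AddCommGroup G]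
    (U : ι → Set B) (hU : ∀ i, IsOpen (U i)) (idx : B → ι) (hidx : ∀ x, x ∈ U (idx x))
    (F : ι → B → G)
    (hF : ∀ i j, ∀ x ∈ U i ∩ U j, ∀ᶠ y in 𝓝 x, F i y - F j y = F i x - F j x) :
    ∃ g : B → G, ∀ i, ∀ x ∈ U i, ∀ᶠ y in 𝓝 x, g y - F i y = g x - F i x := by
  let : TopologicalSpace G := ⊥
  have : DiscreteTopology G := ⟨rfl⟩
  let Z : FiberBundleCore ι B G :=
    { baseSet := U
      isOpen_baseSet := hU
      indexAt := idx
      mem_baseSet_at := hidx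
      coordChange := fun i j x v => v + (F i x - F j x)
      coordChange_self := by simp
      continuousOn_coordChange := by
        rintro i j ⟨x, v⟩ ⟨hx, -⟩
        refine ContinuousAt.continuousWithinAt ?_
        have h1 : Tendsto (fun p : B × G => p.1) (𝓝 (x, v)) (𝓝 x) := continuousAt_fst
        have h2 : ∀ᶠ p : B × G in 𝓝 (x, v), p.2 = v :=
          (continuousAt_snd (p := (x, v))).eventually (by simp [nhds_discrete] : ∀ᶠ g in 𝓝 v, g = v)
        refine tendsto_nhds_of_eventually_eq ?_
        filter_upwards [h1.eventually (hF i j x hx), h2] with p hp1 hp2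
        rw [hp1, hp2]
      coordChange_comp := by
        intro i j k x _ v
        abel }
  have cov : IsCoveringMap Z.proj :=
    IsCoveringMap.mk _ (fun _ => G) (fun x => Z.localTriv (idx x)) fun x => hidx x
  obtain ⟨x₀⟩ : Nonempty B := inferInstance
  obtain ⟨s, ⟨-, hs⟩, -⟩ := cov.existsUnique_continuousMap_lifts (ContinuousMap.id B) x₀
    (⟨x₀, (0 : G)⟩ : Z.TotalSpace) rfl
  have hs' : ∀ x, (s x).1 = x := fun x => congrFun hs x
  let v : B → G := fun x => (s x).2
  refine ⟨fun x => v x + F (idx x) x, fun i x hx => ?_⟩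
  have hmem : s x ∈ (Z.localTriv i).source := by
    rw [Z.mem_localTriv_source, hs']
    exact hx
  have hc : ContinuousAt (fun y => (Z.localTriv i (s y)).2) x :=
    (((Z.localTriv i).continuousAt hmem).comp s.continuous.continuousAt).snd
  have hval : ∀ y, (Z.localTriv i (s y)).2 = v y + (F (idx y) y - F i y) := by
    intro y
    change v y + (F (idx (s y).1) (s y).1 - F i (s y).1) = _
    rw [hs']
  have := hc.eventually (by rw [nhds_discrete]; exact eventually_pure.2 rfl :
    ∀ᶠ w in 𝓝 ((Z.localTriv i (s x)).2), w = (Z.localTriv i (s x)).2)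
  filter_upwards [this] with y hy
  rw [hval, hval] at hy
  simpa [add_sub_assoc] using hy

/-- A holomorphic function on a simply connected open subset of `ℂ` has a primitive. -/
theorem DifferentiableOn.isExactOn_of_simplyConnectedSpace {E : Type*} [NormedAddCommGroup E]
    [NormedSpace ℂ E] [CompleteSpace E] {V : Set ℂ} (hV : IsOpen V) [SimplyConnectedSpace V]
    {f : ℂ → E} (hf : DifferentiableOn ℂ f V) : Complex.IsExactOn f V := by
  have : LocallyPathConnectedSpace V := hV.locallyPathConnectedSpace
  have hloc : ∀ c : V, ∃ r > 0, ∃ F : ℂ → E, ∀ z ∈ ball (c : ℂ) r, HasDerivAt F (f z) z := by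
    intro c
    obtain ⟨r, hr, hrV⟩ := Metric.isOpen_iff.1 hV c c.2
    exact ⟨r, hr, (hf.mono hrV).isExactOn_ball⟩
  choose r hr F hF using hloc
  obtain ⟨g, hg⟩ := exists_sub_eventually_const_of_simplyConnected
    (fun c : V => ((↑) : V → ℂ) ⁻¹' ball (c : ℂ) (r c))
    (fun c => isOpen_ball.preimage continuous_subtype_val) id
    (fun c => mem_ball_self (hr c)) (fun c z => F c z) (by
      rintro i j x ⟨hxi, hxj⟩
      have ho : IsOpen (ball (i : ℂ) (r i) ∩ ball (j : ℂ) (r j)) := isOpen_ball.inter isOpen_ball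
      have hp : IsPreconnected (ball (i : ℂ) (r i) ∩ ball (j : ℂ) (r j)) :=
        ((convex_ball _ _).inter (convex_ball _ _)).isPreconnected
      have hd : ∀ z ∈ ball (i : ℂ) (r i) ∩ ball (j : ℂ) (r j),
          HasDerivAt (fun z => F i z - F j z) 0 z := fun z hz => by
        simpa using (hF i z hz.1).fun_sub (hF j z hz.2)
      filter_upwards [(ho.preimage continuous_subtype_val).mem_nhds (show x ∈ _ from ⟨hxi, hxj⟩)]
        with y hy
      exact ho.is_const_of_deriv_eq_zero hp
        (fun z hz => (hd z hz).differentiableAt.differentiableWithinAt)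
        (fun z hz => (hd z hz).deriv) hy ⟨hxi, hxj⟩)
  classical
  refine ⟨fun z => if h : z ∈ V then g ⟨z, h⟩ else 0, fun z hz => ?_⟩
  have h := hg ⟨z, hz⟩ ⟨z, hz⟩ (mem_ball_self (hr _))
  refine ((hF ⟨z, hz⟩ z (mem_ball_self (hr _))).add_const
    (g ⟨z, hz⟩ - F ⟨z, hz⟩ z)).congr_of_eventuallyEq ?_
  rw [nhds_subtype_eq_comap, eventually_comap] at h
  filter_upwards [h, hV.mem_nhds hz] with y hy hyV
  have := hy ⟨y, hyV⟩ rfl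
  rw [dif_pos hyV, ← this]
  abel

/-- A sequence dominated by the recursion `u (n + 1) = a (n + 1) + u n / 2` with summable `a`
is summable. -/
theorem exists_summable_halving_recursion {a : ℕ → ℝ} (ha : Summable a) (ha0 : ∀ n, 0 ≤ a n) :
    ∃ u : ℕ → ℝ, Summable u ∧ (∀ n, 0 ≤ u n) ∧ u 0 = a 0 ∧
      ∀ n, u (n + 1) = a (n + 1) + u n / 2 := by
  let u : ℕ → ℝ := fun n => Nat.rec (a 0) (fun n x => a (n + 1) + x / 2) n
  have hu : ∀ n, u (n + 1) = a (n + 1) + u n / 2 := fun n => rfl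
  have hu0 : ∀ n, 0 ≤ u n := by
    intro n
    induction n with
    | zero => exact ha0 0
    | succ n ih => rw [hu]; linarith [ha0 (n + 1)]
  have hs : ∀ n, ∑ i ∈ Finset.range (n + 1), u i + u n ≤ 2 * ∑ i ∈ Finset.range (n + 1), a i := by
    intro n
    induction n with
    | zero => simp [u, two_mul]
    | succ n ih =>
      rw [Finset.sum_range_succ, Finset.sum_range_succ _ (n + 1), hu]
      linarith
  refine ⟨u, summable_of_sum_range_le (c := 2 * ∑' i, a i) hu0 fun n => ?_, hu0, rfl, hu⟩
  linarith [hs n, hu0 n, Finset.sum_range_succ u n,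
    ha.sum_le_tsum (Finset.range (n + 1)) fun i _ => ha0 i]

/-- On a simply connected domain in `ℂ`, a holomorphic linear differential equation `W' = A W`
has a global solution with any prescribed initial value. -/
theorem exists_hasDerivAt_linear_of_simplyConnectedSpace {E : Type*} [NormedAddCommGroup E]
    [NormedSpace ℂ E] [CompleteSpace E] {V : Set ℂ} (hV : IsOpen V) [SimplyConnectedSpace V]
    {A : ℂ → E →L[ℂ] E} (hA : DifferentiableOn ℂ A V) {z₀ : ℂ} (hz₀ : z₀ ∈ V) (v : E) :
    ∃ W : ℂ → E, W z₀ = v ∧ ∀ z ∈ V, HasDerivAt W (A z (W z)) z := by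
  have step : ∀ W : {W : ℂ → E // DifferentiableOn ℂ W V}, ∃ W' : {W : ℂ → E //
      DifferentiableOn ℂ W V}, W'.1 z₀ = 0 ∧ ∀ z ∈ V, HasDerivAt W'.1 (A z (W.1 z)) z := by
    intro W
    obtain ⟨g, hg0, hg⟩ :=
      (hA.clm_apply W.2).isExactOn_of_simplyConnectedSpace hV |>.with_val_at z₀ (0 : E)
    exact ⟨⟨g, fun z hz => (hg z hz).differentiableAt.differentiableWithinAt⟩, hg0, hg⟩
  choose T hT0 hT using step
  let P : ℕ → {W : ℂ → E // DifferentiableOn ℂ W V} :=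
    fun n => Nat.rec ⟨fun _ => v, differentiableOn_const v⟩ (fun _ W => T W) n
  let w : ℕ → ℂ → E := fun n => (P n).1
  have hw0 : ∀ z, w 0 z = v := fun z => rfl
  have hwz : ∀ n, w (n + 1) z₀ = 0 := fun n => hT0 (P n)
  have hw : ∀ n, ∀ z ∈ V, HasDerivAt (w (n + 1)) (A z (w n z)) z := fun n => hT (P n)
  -- Summability at one point of a small ball propagates to the whole ball.
  have loc : ∀ c ∈ V, ∃ r > 0, ball c r ⊆ V ∧ ∃ M : ℝ, (∀ z ∈ ball c r, ‖A z‖ ≤ M) ∧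
      ∀ p ∈ ball c r, Summable (fun n => ‖w n p‖) →
        ∃ u : ℕ → ℝ, Summable u ∧ ∀ n, ∀ z ∈ ball c r, ‖w n z‖ ≤ u n := by
    intro c hc
    have hcont : ContinuousAt A c := (hA.differentiableAt (hV.mem_nhds hc)).continuousAt
    have hM : ∀ᶠ z in 𝓝 c, ‖A z‖ < ‖A c‖ + 1 :=
      hcont.norm.eventually (gt_mem_nhds (lt_add_one _))
    obtain ⟨ε, hε, hεV⟩ := Metric.mem_nhds_iff.1 (inter_mem hM (hV.mem_nhds hc))
    set M := ‖A c‖ + 1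
    have hMpos : 0 < M := by positivity
    have hsub : ball c (min ε (1 / (4 * M))) ⊆ ball c ε := ball_subset_ball (min_le_left _ _)
    refine ⟨min ε (1 / (4 * M)), by positivity, fun z hz => (hεV (hsub hz)).2, M,
      fun z hz => (hεV (hsub hz)).1.le, fun p hp hsum => ?_⟩
    obtain ⟨u, hu, hu0, hu_zero, hu_succ⟩ :=
      exists_summable_halving_recursion hsum fun n => norm_nonneg _
    refine ⟨u, hu, fun n => ?_⟩
    induction n with
    | zero =>
      intro z _
      rw [hu_zero, hw0, hw0]
    | succ n ih =>
      intro z hz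
      have hbd : ‖w (n + 1) z - w (n + 1) p‖ ≤ M * u n * ‖z - p‖ :=
        (convex_ball c _).norm_image_sub_le_of_norm_hasDerivWithin_le
          (fun y hy => (hw n y (hεV (hsub hy)).2).hasDerivWithinAt)
          (fun y hy => ((A y).le_opNorm _).trans
            (mul_le_mul (hεV (hsub hy)).1.le (ih y hy) (norm_nonneg _) hMpos.le)) hp hz
      have hdist : ‖z - p‖ ≤ 1 / (2 * M) := by
        have h1 := mem_ball.1 (ball_subset_ball (min_le_right _ _) hz)
        have h2 := mem_ball'.1 (ball_subset_ball (min_le_right _ _) hp)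
        have h3 := dist_triangle z c p
        rw [← dist_eq_norm]
        have : 1 / (2 * M) = 1 / (4 * M) + 1 / (4 * M) := by field_simp; norm_num
        linarith
      have hhalf : M * u n * ‖z - p‖ ≤ u n / 2 :=
        (mul_le_mul_of_nonneg_left hdist (mul_nonneg hMpos.le (hu0 n))).trans_eq (by field_simp)
      rw [hu_succ]
      linarith [norm_le_norm_add_norm_sub' (w (n + 1) z) (w (n + 1) p)]
  choose! r hr hrV M hM hloc using loc
  have hpre : IsPreconnected V := isPreconnected_iff_preconnectedSpace.2 inferInstance
  have hsum : ∀ z ∈ V, Summable fun n => ‖w n z‖ := by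
    have hiff : ∀ c ∈ V, ∀ p ∈ ball c (r c), ∀ q ∈ ball c (r c),
        (Summable fun n => ‖w n p‖) → Summable fun n => ‖w n q‖ := by
      intro c hc p hp q hq h
      obtain ⟨u, hu, hle⟩ := hloc c hc p hp h
      exact hu.of_nonneg_of_le (fun _ => norm_nonneg _) fun n => hle n q hq
    have hz₀sum : Summable fun n => ‖w n z₀‖ := by
      refine (summable_nat_add_iff 1).1 ?_
      simp [hwz]
    refine fun z hz => hpre.induction₂ (fun x y => (Summable fun n => ‖w n x‖) ↔
      Summable fun n => ‖w n y‖) (fun c hc => ?_) (fun _ _ _ _ _ _ h h' => h.trans h')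
      (fun _ _ _ _ h => h.symm) hz₀ hz |>.1 hz₀sum
    filter_upwards [mem_nhdsWithin_of_mem_nhds (ball_mem_nhds c (hr c hc))] with y hy
    exact ⟨hiff c hc c (mem_ball_self (hr c hc)) y hy, hiff c hc y hy c (mem_ball_self (hr c hc))⟩
  refine ⟨fun z => ∑' n, w n z, ?_, fun z hz => ?_⟩
  · change ∑' n, w n z₀ = v
    rw [tsum_eq_single 0 (fun n hn => ?_), hw0]
    obtain ⟨m, rfl⟩ := Nat.exists_eq_succ_of_ne_zero hn
    exact hwz m
  · have hzb := mem_ball_self (x := z) (hr z hz)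
    obtain ⟨u, hu, hle⟩ := hloc z hz z hzb (hsum z hz)
    have hd := hasDerivAt_tsum_of_isPreconnected (g := fun n => w (n + 1))
      (g' := fun n y => A y (w n y)) (hu.mul_left (M z)) isOpen_ball
      (convex_ball z (r z)).isPreconnected (fun n y hy => hw n y (hrV z hz hy))
      (fun n y hy => ((A y).le_opNorm _).trans
        (mul_le_mul (hM z hz y hy) (hle n y hy) (norm_nonneg _)
          ((norm_nonneg _).trans (hM z hz y hy)))) hzb
      ((summable_nat_add_iff 1).2 (hsum z hz).of_norm) hzb
    rw [(A z).map_tsum (hsum z hz).of_norm]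
    refine (hd.const_add v).congr_of_eventuallyEq ?_
    filter_upwards [hV.mem_nhds hz] with y hy
    rw [(hsum y hy).of_norm.tsum_eq_zero_add, hw0]

/-- On a simply connected domain, Hill's equation has a global solution with prescribed initial
value and initial derivative. -/
theorem exists_hill_solution {V : Set ℂ} (hV : IsOpen V) [SimplyConnectedSpace V] {ρ : ℂ → ℂ}
    (hρ : DifferentiableOn ℂ ρ V) {z₀ : ℂ} (hz₀ : z₀ ∈ V) (a b : ℂ) :
    ∃ w w' : ℂ → ℂ, w z₀ = a ∧ w' z₀ = b ∧ (∀ z ∈ V, HasDerivAt w (w' z) z) ∧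
      ∀ z ∈ V, HasDerivAt w' (-(ρ z / 4 * w z)) z := by
  let A : ℂ → (ℂ × ℂ) →L[ℂ] (ℂ × ℂ) := fun z =>
    (ContinuousLinearMap.inl ℂ ℂ ℂ).comp (ContinuousLinearMap.snd ℂ ℂ ℂ) +
      (-(ρ z / 4)) • (ContinuousLinearMap.inr ℂ ℂ ℂ).comp (ContinuousLinearMap.fst ℂ ℂ ℂ)
  have hA : DifferentiableOn ℂ A V :=
    (differentiableOn_const _).add ((hρ.div_const 4).neg.smul_const _)
  obtain ⟨W, hW0, hW⟩ := exists_hasDerivAt_linear_of_simplyConnectedSpace hV hA hz₀ (a, b)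
  refine ⟨fun z => (W z).1, fun z => (W z).2, congrArg Prod.fst hW0, congrArg Prod.snd hW0, fun z hz => ?_,
    fun z hz => ?_⟩
  · simpa [A, Function.comp_def] using
      (ContinuousLinearMap.fst ℂ ℂ ℂ).hasFDerivAt.comp_hasDerivAt z (hW z hz)
  · simpa [A, Function.comp_def] using
      (ContinuousLinearMap.snd ℂ ℂ ℂ).hasFDerivAt.comp_hasDerivAt z (hW z hz)

/-- On a nonempty simply connected domain `V ⊆ ℂ`, given a holomorphic function `ρ`,
there exist holomorphic solutions `w₁, w₂` of Hill's equation `w'' + (ρ/4) w = 0`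
whose Wronskian is identically `1/2` on `V`. -/
theorem exists_hill_solutions_wronskian
    (V : Set ℂ) (hV : IsOpen V) (hVconn : IsConnected V)
    (hVsc : SimplyConnectedSpace V)
    (ρ : ℂ → ℂ) (hρ : DifferentiableOn ℂ ρ V) :
    ∃ w₁ w₂ : ℂ → ℂ,
      DifferentiableOn ℂ w₁ V ∧ DifferentiableOn ℂ w₂ V ∧
      (∀ z ∈ V, deriv (deriv w₁) z + ρ z / 4 * w₁ z = 0) ∧
      (∀ z ∈ V, deriv (deriv w₂) z + ρ z / 4 * w₂ z = 0) ∧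
      (∀ z ∈ V, w₁ z * deriv w₂ z - w₂ z * deriv w₁ z = 1 / 2) := by
  obtain ⟨z₀, hz₀⟩ := hVconn.nonempty
  obtain ⟨w₁, w₁', h₁, h₁', hw₁, hw₁'⟩ := exists_hill_solution hV hρ hz₀ 1 0
  obtain ⟨w₂, w₂', h₂, h₂', hw₂, hw₂'⟩ := exists_hill_solution hV hρ hz₀ 0 (1 / 2)
  have second : ∀ {w w' : ℂ → ℂ}, (∀ z ∈ V, HasDerivAt w (w' z) z) →
      (∀ z ∈ V, HasDerivAt w' (-(ρ z / 4 * w z)) z) →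
      ∀ z ∈ V, deriv (deriv w) z + ρ z / 4 * w z = 0 := by
    intro w w' hw hw' z hz
    have : deriv w =ᶠ[𝓝 z] w' := by
      filter_upwards [hV.mem_nhds hz] with y hy using (hw y hy).deriv
    rw [this.deriv_eq, (hw' z hz).deriv, neg_add_cancel]
  have hd : ∀ z ∈ V, HasDerivAt (fun z => w₁ z * w₂' z - w₂ z * w₁' z) 0 z := by
    intro z hz
    exact (((hw₁ z hz).fun_mul (hw₂' z hz)).fun_sub
      ((hw₂ z hz).fun_mul (hw₁' z hz))).congr_deriv (by ring)
  refine ⟨w₁, w₂, fun z hz => (hw₁ z hz).differentiableAt.differentiableWithinAt,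
    fun z hz => (hw₂ z hz).differentiableAt.differentiableWithinAt,
    second hw₁ hw₁', second hw₂ hw₂', fun z hz => ?_⟩
  rw [(hw₁ z hz).deriv, (hw₂ z hz).deriv]
  have := hV.is_const_of_deriv_eq_zero hVconn.isPreconnected
    (fun y hy => (hd y hy).differentiableAt.differentiableWithinAt)
    (fun y hy => (hd y hy).deriv) hz hz₀
  simpa [h₁, h₁', h₂, h₂'] using this
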